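/- arXiv:1910.09310 — 2 statements merged into one kernel-verified Lean document; each statement's English description precedes it below -/
import Mathlib

section
/- For every ε > 0 there is a constant C_ε such that, as multiplication operators on L²(ℝ⁴), |∇w_R(x₁ - x₂)|² ≤ C_ε R^{-ε} (p₁² + 1), where p₁ = -i∇_{x₁}; i.e. for all f in the form domain, ∬ |∇w_R(x₁-x₂)|² |f|² dx₁dx₂ ≤ C_ε R^{-ε} (‖∇_{x₁} f‖² + ‖f‖²). -/
open MeasureTheory
noncomputable section

abbrev E2 := EuclideanSpace ℝ (Fin 2)

lemma kern_integrable :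
    Integrable (fun x : E2 => Set.indicator (Set.Iio (1:ℝ)) (fun t => t⁻¹) ‖x‖) := by
  rw [integrable_fun_norm_addHaar (volume : Measure E2) (f := Set.indicator (Set.Iio (1:ℝ)) (fun t => t⁻¹))]
  have h : IntegrableOn (Set.indicator (Set.Iio (1:ℝ)) (fun _ => (1:ℝ))) (Set.Ioi 0) := by
    rw [IntegrableOn, integrable_indicator_iff measurableSet_Iio, IntegrableOn,
      Measure.restrict_restrict measurableSet_Iio]
    refine integrableOn_const ?_
    have : Set.Iio (1:ℝ) ∩ Set.Ioi 0 = Set.Ioo 0 1 := by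
      ext x; simp [and_comm]
    rw [this]; simp
  refine h.congr_fun ?_ measurableSet_Ioi
  intro x hx
  have hx' : (0:ℝ) < x := hx
  by_cases h1 : x < 1
  · simp [Set.indicator, h1, hx'.ne']
  · simp [Set.indicator, h1]

lemma kern_bound (x : E2) :
    ‖x‖⁻¹ ≤ Set.indicator (Set.Iio (1:ℝ)) (fun t => t⁻¹) ‖x‖ + 1 := by
  by_cases h1 : ‖x‖ < 1
  · simp [Set.indicator, h1]
  · simp only [Set.indicator, Set.mem_Iio, h1, if_false, zero_add]
    exact inv_le_one_of_one_le₀ (not_lt.mp h1)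

lemma kern_nonneg (x : E2) :
    0 ≤ Set.indicator (Set.Iio (1:ℝ)) (fun t => t⁻¹) ‖x‖ := by
  by_cases h1 : ‖x‖ < 1
  · simp [Set.indicator, h1]
  · simp [Set.indicator, h1]

lemma pot_unit (χ : E2 → ℝ) (hc : Continuous χ) (hint : Integrable χ)
    (h0 : ∀ x, 0 ≤ χ x) (hm : ∫ x, χ x = 1) (M : ℝ) (hM : ∀ x, χ x ≤ M)
    (hout : ∀ x : E2, 2 ≤ ‖x‖ → χ x = 0) :
    ∃ K : ℝ, 0 < K ∧ ∀ u : E2, Integrable (fun y => ‖u - y‖⁻¹ * χ y) ∧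
      (1 + ‖u‖) * ∫ y, ‖u - y‖⁻¹ * χ y ≤ K := by
  set N : E2 → ℝ := fun x => Set.indicator (Set.Iio (1:ℝ)) (fun t => t⁻¹) ‖x‖ with hN
  have hM0 : 0 ≤ M := (h0 0).trans (hM 0)
  have hNi : 0 ≤ ∫ x, N x := integral_nonneg kern_nonneg
  have hb : ∀ u y : E2, ‖u - y‖⁻¹ * χ y ≤ M * N (u - y) + χ y := by
    intro u y
    have h1 := kern_bound (u - y)
    have h2 : ‖u - y‖⁻¹ * χ y ≤ (N (u - y) + 1) * χ y :=
      mul_le_mul_of_nonneg_right h1 (h0 y)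
    have h3 : N (u - y) * χ y ≤ N (u - y) * M :=
      mul_le_mul_of_nonneg_left (hM y) (kern_nonneg _)
    linarith
  have hbi : ∀ u : E2, Integrable (fun y => M * N (u - y) + χ y) := fun u =>
    ((kern_integrable.comp_sub_left u).const_mul M).add hint
  have hi : ∀ u : E2, Integrable (fun y => ‖u - y‖⁻¹ * χ y) := by
    intro u
    refine (hbi u).mono' (by fun_prop) (Filter.Eventually.of_forall fun y => ?_)
    rw [Real.norm_of_nonneg (mul_nonneg (inv_nonneg.2 (norm_nonneg _)) (h0 y))]
    exact hb u y
  refine ⟨3 * (M * (∫ x, N x) + 1) + 1, by positivity, fun u => ⟨hi u, ?_⟩⟩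
  have hH : ∫ y, ‖u - y‖⁻¹ * χ y ≤ M * (∫ x, N x) + 1 := by
    calc _ ≤ ∫ y, (M * N (u - y) + χ y) := integral_mono (hi u) (hbi u) (hb u)
      _ = _ := by
        rw [integral_add ((kern_integrable.comp_sub_left u).const_mul M) hint, hm,
          integral_const_mul, integral_sub_left_eq_self N volume u]
  calc (1 + ‖u‖) * ∫ y, ‖u - y‖⁻¹ * χ y = ∫ y, (1 + ‖u‖) * (‖u - y‖⁻¹ * χ y) :=
        (integral_const_mul _ _).symm
    _ ≤ ∫ y, (3 * (‖u - y‖⁻¹ * χ y) + χ y) := by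
        refine integral_mono ((hi u).const_mul _) (((hi u).const_mul _).add hint) fun y => ?_
        show (1 + ‖u‖) * (‖u - y‖⁻¹ * χ y) ≤ 3 * (‖u - y‖⁻¹ * χ y) + χ y
        by_cases hy : 2 ≤ ‖y‖
        · simp [hout y hy]
        · have h1 : ‖u‖ ≤ ‖u - y‖ + ‖y‖ := by simpa using norm_add_le (u - y) y
          have h2 : ‖u - y‖ * ‖u - y‖⁻¹ ≤ 1 := mul_inv_le_one
          have h3 : 0 ≤ ‖u - y‖⁻¹ := inv_nonneg.2 (norm_nonneg _)
          have h4 : (1 + ‖u‖) * ‖u - y‖⁻¹ ≤ (3 + ‖u - y‖) * ‖u - y‖⁻¹ :=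
            mul_le_mul_of_nonneg_right (by linarith [not_le.mp hy]) h3
          have h5 : (1 + ‖u‖) * ‖u - y‖⁻¹ ≤ 3 * ‖u - y‖⁻¹ + 1 := by linarith
          have := mul_le_mul_of_nonneg_right h5 (h0 y)
          linarith
    _ = 3 * (∫ y, ‖u - y‖⁻¹ * χ y) + 1 := by
        rw [integral_add ((hi u).const_mul _) hint, hm, integral_const_mul]
    _ ≤ _ := by linarith

lemma pot_scaled (χ : E2 → ℝ) (K : ℝ)
    (hK : ∀ u : E2, Integrable (fun y => ‖u - y‖⁻¹ * χ y) ∧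
      (1 + ‖u‖) * ∫ y, ‖u - y‖⁻¹ * χ y ≤ K) (R : ℝ) (hR : 0 < R) (u : E2) :
    Integrable (fun y => ‖u - y‖⁻¹ * (R ^ (-2 : ℤ) * χ (R⁻¹ • y))) ∧
      ∫ y, ‖u - y‖⁻¹ * (R ^ (-2 : ℤ) * χ (R⁻¹ • y)) ≤ K / (R + ‖u‖) := by
  have key : (fun y => ‖u - y‖⁻¹ * (R ^ (-2 : ℤ) * χ (R⁻¹ • y))) =
      fun y => (R⁻¹ * R ^ (-2 : ℤ)) * (fun x => ‖R⁻¹ • u - x‖⁻¹ * χ x) (R⁻¹ • y) := by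
    ext y
    simp only
    rw [← smul_sub, norm_smul, Real.norm_of_nonneg (inv_nonneg.2 hR.le), mul_inv, inv_inv]
    field_simp
  obtain ⟨h1, h2⟩ := hK (R⁻¹ • u)
  rw [key]
  refine ⟨(h1.comp_smul (inv_ne_zero hR.ne')).const_mul _, ?_⟩
  rw [integral_const_mul, Measure.integral_comp_inv_smul_of_nonneg volume (fun x => ‖R⁻¹ • u - x‖⁻¹ * χ x) hR.le]
  rw [norm_smul, Real.norm_of_nonneg (inv_nonneg.2 hR.le)] at h2
  have : 0 < R + ‖u‖ := by positivity
  rw [le_div_iff₀ this]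
  refine le_trans (le_of_eq ?_) h2
  simp only [finrank_euclideanSpace_fin, smul_eq_mul]
  rw [zpow_neg]
  norm_cast
  field_simp

lemma log_diff {a b : ℝ} (ha : 0 < a) (hb : 0 < b) :
    |Real.log a - Real.log b| ≤ |a - b| * (a⁻¹ + b⁻¹) := by
  have aux : ∀ {a b : ℝ}, 0 < a → 0 < b → Real.log a - Real.log b ≤ |a - b| * (a⁻¹ + b⁻¹) := by
    intro a b ha hb
    rw [← Real.log_div ha.ne' hb.ne']
    have h1 := Real.log_le_sub_one_of_pos (div_pos ha hb)
    have h2 : a / b - 1 = (a - b) * b⁻¹ := by field_simp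
    have h3 : (a - b) * b⁻¹ ≤ |a - b| * b⁻¹ :=
      mul_le_mul_of_nonneg_right (le_abs_self _) (inv_nonneg.2 hb.le)
    have h4 : 0 ≤ |a - b| * a⁻¹ := by positivity
    linarith
  rw [abs_le]
  constructor
  · have := aux hb ha
    rw [abs_sub_comm] at this
    linarith
  · exact aux ha hb

lemma abs_log_le {t : ℝ} (ht : 0 ≤ t) : |Real.log t| ≤ t⁻¹ + t := by
  rcases ht.eq_or_lt with rfl | ht
  · simp
  have h1 := Real.log_le_sub_one_of_pos ht
  have h2 := Real.log_le_sub_one_of_pos (inv_pos.2 ht)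
  rw [Real.log_inv] at h2
  have := inv_pos.2 ht
  rw [abs_le]
  constructor <;> linarith

lemma grad_bound (g : E2 → ℝ) (hc : Continuous g) (hs : HasCompactSupport g)
    (h0 : ∀ x, 0 ≤ g x) (K R : ℝ) (hK : 0 < K) (hR : 0 < R)
    (hpot : ∀ u : E2, Integrable (fun y => ‖u - y‖⁻¹ * g y) ∧
      ∫ y, ‖u - y‖⁻¹ * g y ≤ K / (R + ‖u‖)) (v : E2) :
    ‖gradient (fun v : E2 => ∫ y : E2, Real.log ‖v - y‖ * g y) v‖ ^ 2
      ≤ 9 * K ^ 2 * (‖v‖ ^ 2 + R ^ 2)⁻¹ := by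
  have hint : ∀ u : E2, Integrable (fun y => Real.log ‖u - y‖ * g y) := by
    intro u
    have hi2 : Integrable (fun y => ‖u - y‖ * g y) :=
      (by fun_prop : Continuous (fun y => ‖u - y‖ * g y)).integrable_of_hasCompactSupport
        hs.mul_left
    refine ((hpot u).1.add hi2).mono' ?_ (Filter.Eventually.of_forall fun y => ?_)
    · refine Measurable.aestronglyMeasurable ?_
      have := hc.measurable
      fun_prop
    · rw [norm_mul, Real.norm_of_nonneg (h0 y), Real.norm_eq_abs]
      have := mul_le_mul_of_nonneg_right (abs_log_le (norm_nonneg (u - y))) (h0 y)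
      simp only [Pi.add_apply]
      linarith
  have hlip : ∀ u : E2, ‖(∫ y, Real.log ‖u - y‖ * g y) - ∫ y, Real.log ‖v - y‖ * g y‖
      ≤ ‖u - v‖ * (K / (R + ‖u‖) + K / (R + ‖v‖)) := by
    intro u
    rw [← integral_sub (hint u) (hint v)]
    calc _ ≤ ∫ y, ‖u - v‖ * (‖u - y‖⁻¹ * g y + ‖v - y‖⁻¹ * g y) := by
          refine norm_integral_le_of_norm_le (((hpot u).1.add (hpot v).1).const_mul _) ?_
          have hu : ∀ᵐ y : E2, y ≠ u := by simp [ae_iff]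
          have hv : ∀ᵐ y : E2, y ≠ v := by simp [ae_iff]
          filter_upwards [hu, hv] with y hyu hyv
          have a0 : 0 < ‖u - y‖ := norm_pos_iff.2 (sub_ne_zero.2 hyu.symm)
          have b0 : 0 < ‖v - y‖ := norm_pos_iff.2 (sub_ne_zero.2 hyv.symm)
          rw [← sub_mul, norm_mul, Real.norm_of_nonneg (h0 y), Real.norm_eq_abs]
          have h1 := log_diff a0 b0
          have h2 : |‖u - y‖ - ‖v - y‖| ≤ ‖u - v‖ := by
            simpa using abs_norm_sub_norm_le (u - y) (v - y)
          have h3 : |Real.log ‖u - y‖ - Real.log ‖v - y‖| ≤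
              ‖u - v‖ * (‖u - y‖⁻¹ + ‖v - y‖⁻¹) :=
            h1.trans (mul_le_mul_of_nonneg_right h2 (by positivity))
          have := mul_le_mul_of_nonneg_right h3 (h0 y)
          linarith
      _ = ‖u - v‖ * ((∫ y, ‖u - y‖⁻¹ * g y) + ∫ y, ‖v - y‖⁻¹ * g y) := by
          rw [integral_const_mul, integral_add (hpot u).1 (hpot v).1]
      _ ≤ _ := by
          gcongr
          · exact (hpot u).2
          · exact (hpot v).2
  have hv0 : 0 < R + ‖v‖ := by positivity
  have hG : ‖gradient (fun v : E2 => ∫ y : E2, Real.log ‖v - y‖ * g y) v‖ ≤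
      3 * K / (R + ‖v‖) := by
    rw [gradient, LinearIsometryEquiv.norm_map]
    refine norm_fderiv_le_of_lip' ℝ (by positivity) ?_
    filter_upwards [Metric.ball_mem_nhds v (half_pos hR)] with u hu
    rw [Metric.mem_ball, dist_eq_norm] at hu
    refine (hlip u).trans ?_
    rw [mul_comm]
    refine mul_le_mul_of_nonneg_right ?_ (norm_nonneg _)
    have h1 : ‖v‖ ≤ ‖u‖ + ‖u - v‖ := by
      have := norm_sub_norm_le v u
      rw [norm_sub_rev] at this; linarith
    have h2 : K / (R + ‖u‖) ≤ K / ((R + ‖v‖) / 2) := by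
      refine div_le_div_of_nonneg_left hK.le (by positivity) ?_
      linarith [norm_nonneg u]
    have h3 : K / ((R + ‖v‖) / 2) + K / (R + ‖v‖) = 3 * K / (R + ‖v‖) := by
      field_simp; ring
    linarith
  calc _ ≤ (3 * K / (R + ‖v‖)) ^ 2 := pow_le_pow_left₀ (norm_nonneg _) hG 2
    _ = 9 * K ^ 2 * ((R + ‖v‖) ^ 2)⁻¹ := by field_simp; ring
    _ ≤ _ := by
      gcongr
      nlinarith [norm_nonneg v]

lemma haar4 : Measure.IsAddHaarMeasure (volume : Measure (E2 × E2)) := by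
  rw [Measure.volume_eq_prod]; infer_instance

/-- derivative of the `j`-th component of the vector field -/
lemma field_deriv (R s : ℝ) (hR : 0 < R) (j : Fin 2) (z : E2 × E2) :
    fderiv ℝ (fun z : E2 × E2 => (z.1 - z.2) j * (‖z.1 - z.2‖ ^ 2 + R ^ 2) ^ (s - 1)) z
      (EuclideanSpace.single j 1, 0) =
    (‖z.1 - z.2‖ ^ 2 + R ^ 2) ^ (s - 1) +
      2 * (s - 1) * ((z.1 - z.2) j) ^ 2 * (‖z.1 - z.2‖ ^ 2 + R ^ 2) ^ (s - 2) := by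
  have hd : HasFDerivAt (fun z : E2 × E2 => z.1 - z.2)
      (ContinuousLinearMap.fst ℝ E2 E2 - ContinuousLinearMap.snd ℝ E2 E2) z :=
    (ContinuousLinearMap.fst ℝ E2 E2 - ContinuousLinearMap.snd ℝ E2 E2).hasFDerivAt
  have h1 : HasFDerivAt (fun z : E2 × E2 => (z.1 - z.2) j) _ z :=
    ((EuclideanSpace.proj j : E2 →L[ℝ] ℝ).hasFDerivAt).comp z hd
  have hq : ‖z.1 - z.2‖ ^ 2 + R ^ 2 ≠ 0 := by positivity
  have h2 := (hd.norm_sq.add_const (R ^ 2)).rpow_const (p := s - 1) (Or.inl hq)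
  refine (congrArg (fun L : E2 × E2 →L[ℝ] ℝ => L (EuclideanSpace.single j 1, 0))
    (h1.mul h2).fderiv).trans ?_
  have e : s - 1 - 1 = s - 2 := by ring
  simp [e, EuclideanSpace.inner_single_right]
  ring

lemma field_contDiff (R s : ℝ) (hR : 0 < R) (j : Fin 2) :
    ContDiff ℝ 1 (fun z : E2 × E2 => (z.1 - z.2) j * (‖z.1 - z.2‖ ^ 2 + R ^ 2) ^ (s - 1)) := by
  have hd : ContDiff ℝ 1 (fun z : E2 × E2 => z.1 - z.2) := by fun_prop
  have h1 : ContDiff ℝ 1 (fun z : E2 × E2 => (z.1 - z.2) j) :=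
    (EuclideanSpace.proj j : E2 →L[ℝ] ℝ).contDiff.comp hd
  refine h1.mul (ContDiff.rpow_const_of_ne (hd.norm_sq ℝ |>.add contDiff_const) ?_)
  intro z; positivity

lemma slice_deriv (f : E2 × E2 → ℂ) (hf : ContDiff ℝ (⊤ : ℕ∞) f) (z : E2 × E2) (e : E2) :
    fderiv ℝ (fun y : E2 => f (y, z.2)) z.1 e = fderiv ℝ f z (e, 0) := by
  have h : HasFDerivAt f (fderiv ℝ f z) (z.1, z.2) :=
    (hf.differentiable (by simp)).differentiableAt.hasFDerivAt
  have h2 : HasFDerivAt (fun y : E2 => (y, z.2)) (ContinuousLinearMap.inl ℝ E2 E2) z.1 :=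
    hasFDerivAt_prodMk_left z.1 z.2
  have := h.comp z.1 h2
  rw [show (fun y : E2 => f (y, z.2)) = f ∘ (fun y : E2 => (y, z.2)) from rfl, this.fderiv]
  simp

lemma pointwise (s q F A B x : ℝ) (hs : 0 < s) (hs2 : s ≤ 1 / 2) (hq : 0 < q) (hA : 0 ≤ A)
    (hB : 0 ≤ B) (hx : x ^ 2 ≤ q) (hF : |F| ≤ 2 * A * B) :
    -(x * q ^ (s - 1) * F) ≤ (s / 2) * (q ^ (s - 1) * A ^ 2 + A ^ 2) + (2 / s) * B ^ 2 := by
  have hp : 0 < q ^ (s - 1) := Real.rpow_pos_of_pos hq _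
  have h1 : (x * q ^ (s - 1)) ^ 2 ≤ q ^ (s - 1) + 1 := by
    have e : q * (q ^ (s - 1) * q ^ (s - 1)) = q ^ (2 * s - 1) := by
      nth_rewrite 1 [← Real.rpow_one q]
      rw [← Real.rpow_add hq, ← Real.rpow_add hq]
      congr 1; ring
    have e2 : (x * q ^ (s - 1)) ^ 2 ≤ q ^ (2 * s - 1) := by
      rw [← e]; nlinarith [mul_pos hp hp]
    refine e2.trans ?_
    rcases le_total q 1 with h | h
    · have := Real.rpow_le_rpow_of_exponent_ge hq h (show s - 1 ≤ 2 * s - 1 by linarith)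
      linarith
    · have := Real.rpow_le_one_of_one_le_of_nonpos h (show 2 * s - 1 ≤ 0 by linarith)
      linarith
  set y := x * q ^ (s - 1)
  have h2 : -(y * F) ≤ 2 * (|y| * A) * B := by
    calc -(y * F) ≤ |y * F| := neg_le_abs _
      _ = |y| * |F| := abs_mul _ _
      _ ≤ |y| * (2 * A * B) := by gcongr
      _ = _ := by ring
  have h3 : 2 * (|y| * A) * B ≤ (s / 2) * (|y| * A) ^ 2 + (2 / s) * B ^ 2 := by
    have : (s / 2) * (|y| * A) ^ 2 + (2 / s) * B ^ 2 - 2 * (|y| * A) * B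
      = (2 / s) * (s / 2 * (|y| * A) - B) ^ 2 := by field_simp; ring
    have h : 0 ≤ (2 / s) * (s / 2 * (|y| * A) - B) ^ 2 := by positivity
    linarith
  have h4 : (|y| * A) ^ 2 ≤ q ^ (s - 1) * A ^ 2 + A ^ 2 := by
    rw [mul_pow, sq_abs]
    have := mul_le_mul_of_nonneg_right h1 (sq_nonneg A)
    linarith
  have h5 := mul_le_mul_of_nonneg_left h4 (show 0 ≤ s / 2 by positivity)
  linarith

lemma hardy (R s : ℝ) (hR : 0 < R) (hs : 0 < s) (hs2 : s ≤ 1 / 2)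
    (f : E2 × E2 → ℂ) (hf : ContDiff ℝ (⊤ : ℕ∞) f) (hfs : HasCompactSupport f) :
    ∫ z : E2 × E2, (‖z.1 - z.2‖ ^ 2 + R ^ 2) ^ (s - 1) * ‖f z‖ ^ 2 ≤
      (1 + 4 / s ^ 2) * ((∫ z : E2 × E2, ∑ j : Fin 2,
                  ‖fderiv ℝ (fun y : E2 => f (y, z.2)) z.1 (EuclideanSpace.single j 1)‖ ^ 2)
                + ∫ z : E2 × E2, ‖f z‖ ^ 2) := by
  have := haar4
  simp only [slice_deriv f hf]
  have hfc : Continuous f := hf.continuous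
  have hfd : Differentiable ℝ f := hf.differentiable (by simp)
  have hφ : ContDiff ℝ 1 (fun z => ‖f z‖ ^ 2) := (hf.of_le (by simp)).norm_sq ℝ
  have hφs : HasCompactSupport (fun z => ‖f z‖ ^ 2) := by
    refine hfs.mono ?_
    intro z hz; contrapose! hz; simp at hz; simp [hz]
  have hqc : Continuous (fun z : E2 × E2 => (‖z.1 - z.2‖ ^ 2 + R ^ 2) ^ (s - 1)) := by
    refine Continuous.rpow_const (by fun_prop) ?_
    intro z; left; positivity
  have hD : ∀ e : E2 × E2, Continuous (fun z => fderiv ℝ f z e) := fun e =>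
    (hf.continuous_fderiv (by simp)).clm_apply continuous_const
  have hDs : ∀ e : E2 × E2, HasCompactSupport (fun z => fderiv ℝ f z e) := fun e =>
    hfs.fderiv_apply ℝ e
  have hφD : ∀ e : E2 × E2, ∀ z, |fderiv ℝ (fun z => ‖f z‖ ^ 2) z e| ≤
      2 * ‖f z‖ * ‖fderiv ℝ f z e‖ := by
    intro e z
    rw [((hfd z).hasFDerivAt.norm_sq).fderiv]
    have := abs_real_inner_le_norm (f z) (fderiv ℝ f z e)
    have e1 : (2 • (innerSL ℝ) (f z) ∘SL (fderiv ℝ f z)) e =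
        2 * inner ℝ (f z) (fderiv ℝ f z e) := by
      simp only [ContinuousLinearMap.smul_apply, ContinuousLinearMap.comp_apply,
        innerSL_apply_apply, nsmul_eq_mul]
      norm_num
    rw [e1, abs_mul, abs_two]
    linarith
  have iφ : Integrable (fun z => ‖f z‖ ^ 2) := hφ.continuous.integrable_of_hasCompactSupport hφs
  have iI : Integrable (fun z : E2 × E2 => (‖z.1 - z.2‖ ^ 2 + R ^ 2) ^ (s - 1) * ‖f z‖ ^ 2) :=
    (hqc.mul hφ.continuous).integrable_of_hasCompactSupport hφs.mul_left
  have iD : ∀ e : E2 × E2, Integrable (fun z => ‖fderiv ℝ f z e‖ ^ 2) := by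
    intro e
    refine ((hD e).norm.pow 2).integrable_of_hasCompactSupport ?_
    refine (hDs e).mono ?_
    intro z hz; contrapose! hz; simp at hz; simp [hz]
  -- integration by parts
  have ibp : ∀ j : Fin 2, 
      Integrable (fun z : E2 × E2 => ((‖z.1 - z.2‖ ^ 2 + R ^ 2) ^ (s - 1) +
      2 * (s - 1) * ((z.1 - z.2) j) ^ 2 * (‖z.1 - z.2‖ ^ 2 + R ^ 2) ^ (s - 2)) * ‖f z‖ ^ 2) ∧
      ∫ z : E2 × E2, ((‖z.1 - z.2‖ ^ 2 + R ^ 2) ^ (s - 1) +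
      2 * (s - 1) * ((z.1 - z.2) j) ^ 2 * (‖z.1 - z.2‖ ^ 2 + R ^ 2) ^ (s - 2)) * ‖f z‖ ^ 2 ≤
      (s / 2) * ((∫ z : E2 × E2, (‖z.1 - z.2‖ ^ 2 + R ^ 2) ^ (s - 1) * ‖f z‖ ^ 2) +
        ∫ z, ‖f z‖ ^ 2) +
      (2 / s) * ∫ z, ‖fderiv ℝ f z (EuclideanSpace.single j 1, 0)‖ ^ 2 := by
    intro j
    have hF := field_contDiff R s hR j
    have hF' : Continuous (fun z => fderiv ℝ (fun z : E2 × E2 =>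
      (z.1 - z.2) j * (‖z.1 - z.2‖ ^ 2 + R ^ 2) ^ (s - 1)) z (EuclideanSpace.single j 1, 0)) :=
      (hF.continuous_fderiv (by simp)).clm_apply continuous_const
    have hφ' : Continuous (fun z => fderiv ℝ (fun z => ‖f z‖ ^ 2) z
        ((EuclideanSpace.single j 1 : E2), (0 : E2))) :=
      (hφ.continuous_fderiv (by simp)).clm_apply continuous_const
    have i1 := (hF'.mul hφ.continuous).integrable_of_hasCompactSupport (μ := volume) hφs.mul_left
    have i2 := (hF.continuous.mul hφ').integrable_of_hasCompactSupport (μ := volume)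
      (hφs.fderiv_apply ℝ _).mul_left
    have i3 := (hF.continuous.mul hφ.continuous).integrable_of_hasCompactSupport (μ := volume)
      hφs.mul_left
    have key := integral_mul_fderiv_eq_neg_fderiv_mul_of_integrable i1 i2 i3
      (fun z _ => (hF.differentiable (by simp)) z) (fun z _ => (hφ.differentiable (by simp)) z)
    simp only [field_deriv R s hR j] at key i1
    refine ⟨i1, ?_⟩
    rw [← neg_eq_iff_eq_neg] at key
    rw [← key, ← integral_neg]
    calc _ ≤ ∫ z : E2 × E2, ((s / 2) * ((‖z.1 - z.2‖ ^ 2 + R ^ 2) ^ (s - 1) * ‖f z‖ ^ 2 +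
              ‖f z‖ ^ 2) + (2 / s) * ‖fderiv ℝ f z (EuclideanSpace.single j 1, 0)‖ ^ 2) := by
          refine integral_mono i2.neg (((iI.add iφ).const_mul _).add ((iD _).const_mul _)) ?_
          intro z
          refine pointwise s _ _ _ _ _ hs hs2 (by positivity) (norm_nonneg _) (norm_nonneg _) ?_
            (hφD _ z)
          have h1 : ((z.1 - z.2) j) ^ 2 ≤ ‖z.1 - z.2‖ ^ 2 := by
            have := PiLp.norm_apply_le (z.1 - z.2) j
            rw [← sq_abs, ← Real.norm_eq_abs]
            exact pow_le_pow_left₀ (norm_nonneg _) this 2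
          nlinarith
      _ = _ := by
          have iS : Integrable (fun z : E2 × E2 => (‖z.1 - z.2‖ ^ 2 + R ^ 2) ^ (s - 1) * ‖f z‖ ^ 2 +
              ‖f z‖ ^ 2) := iI.add iφ
          rw [integral_add (iS.const_mul _) ((iD _).const_mul _), integral_const_mul,
            integral_const_mul, integral_add iI iφ]
  have hdiv : 2 * s * ∫ z : E2 × E2, (‖z.1 - z.2‖ ^ 2 + R ^ 2) ^ (s - 1) * ‖f z‖ ^ 2 ≤
      ∑ j : Fin 2, ∫ z : E2 × E2, ((‖z.1 - z.2‖ ^ 2 + R ^ 2) ^ (s - 1) +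
      2 * (s - 1) * ((z.1 - z.2) j) ^ 2 * (‖z.1 - z.2‖ ^ 2 + R ^ 2) ^ (s - 2)) * ‖f z‖ ^ 2 := by
    rw [← integral_finsetSum _ (fun j _ => (ibp j).1), ← integral_const_mul]
    refine integral_mono (iI.const_mul _) (integrable_finsetSum _ (fun j _ => (ibp j).1)) ?_
    intro z
    simp only [Fin.sum_univ_two]
    have hq : 0 < ‖z.1 - z.2‖ ^ 2 + R ^ 2 := by positivity
    have hn : ‖z.1 - z.2‖ ^ 2 = ((z.1 - z.2) 0) ^ 2 + ((z.1 - z.2) 1) ^ 2 := by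
      rw [EuclideanSpace.real_norm_sq_eq, Fin.sum_univ_two]
    have e : (‖z.1 - z.2‖ ^ 2 + R ^ 2) ^ (s - 1) =
        (‖z.1 - z.2‖ ^ 2 + R ^ 2) * (‖z.1 - z.2‖ ^ 2 + R ^ 2) ^ (s - 2) := by
      rw [← Real.rpow_one_add' hq.le (by linarith)]
      congr 1; ring
    rw [e]
    have hp : 0 < (‖z.1 - z.2‖ ^ 2 + R ^ 2) ^ (s - 2) := Real.rpow_pos_of_pos hq _
    generalize (‖z.1 - z.2‖ ^ 2 + R ^ 2) ^ (s - 2) = p at *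
    rw [hn]
    have h : 0 ≤ 2 * (1 - s) * R ^ 2 * p * ‖f z‖ ^ 2 := by
      have : 0 ≤ 1 - s := by linarith
      positivity
    nlinarith
  rw [integral_finsetSum _ (fun j _ => iD _)]
  simp only [Fin.sum_univ_two] at hdiv ⊢
  have b0 := (ibp 0).2
  have b1 := (ibp 1).2
  have hA : 0 ≤ ∫ z, ‖f z‖ ^ 2 := integral_nonneg fun z => by positivity
  have hB0 : 0 ≤ ∫ z, ‖fderiv ℝ f z (EuclideanSpace.single 0 1, 0)‖ ^ 2 :=
    integral_nonneg fun z => by positivity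
  have hB1 : 0 ≤ ∫ z, ‖fderiv ℝ f z (EuclideanSpace.single 1 1, 0)‖ ^ 2 :=
    integral_nonneg fun z => by positivity
  generalize (∫ z : E2 × E2, (‖z.1 - z.2‖ ^ 2 + R ^ 2) ^ (s - 1) * ‖f z‖ ^ 2) = I at *
  generalize (∫ z, ‖f z‖ ^ 2) = A at *
  generalize (∫ z, ‖fderiv ℝ f z (EuclideanSpace.single 0 1, 0)‖ ^ 2) = B0 at *
  generalize (∫ z, ‖fderiv ℝ f z (EuclideanSpace.single 1 1, 0)‖ ^ 2) = B1 at *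
  have h1 : s * I ≤ s * A + (2 / s) * (B0 + B1) := by linarith
  have h2 : I ≤ A + (2 / s ^ 2) * (B0 + B1) := by
    have : s * (A + (2 / s ^ 2) * (B0 + B1)) = s * A + (2 / s) * (B0 + B1) := by
      field_simp
    rw [← this] at h1
    exact le_of_mul_le_mul_left h1 hs
  have h3 : 0 ≤ (2 / s ^ 2) * (B0 + B1) := by positivity
  have h4 : 0 ≤ (4 / s ^ 2) * A := by positivity
  have h5 : (4 / s ^ 2) * (B0 + B1) = 2 * ((2 / s ^ 2) * (B0 + B1)) := by ring
  nlinarith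

/-- Singular two-body term: for every `ε > 0`,
`|∇w_R(x₁-x₂)|² ≤ C_ε R^{-ε} (p₁² + 1)` as quadratic forms on `L²(ℝ⁴)`. -/
theorem singular_two_body_term
    (χ : E2 → ℝ)
    (hχ_smooth : ContDiff ℝ (⊤ : ℕ∞) χ)
    (hχ_radial : ∀ x y : E2, ‖x‖ = ‖y‖ → χ x = χ y)
    (hχ_nonneg : ∀ x, 0 ≤ χ x)
    (hχ_mass : ∫ x, χ x = 1)
    (hχ_inner : ∀ x : E2, ‖x‖ ≤ 1 → χ x = 1 / Real.pi ^ 2)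
    (hχ_outer : ∀ x : E2, 2 ≤ ‖x‖ → χ x = 0)
    (ε : ℝ) (hε : 0 < ε) :
    ∃ C : ℝ, 0 < C ∧
      ∀ R : ℝ, 0 < R → R ≤ 1 →
        ∀ (f : E2 × E2 → ℂ), ContDiff ℝ (⊤ : ℕ∞) f → HasCompactSupport f →
          (∫ z : E2 × E2,
              ‖gradient (fun v : E2 => ∫ y : E2,
                  Real.log ‖v - y‖ * (R ^ (-2 : ℤ) * χ (R⁻¹ • y))) (z.1 - z.2)‖ ^ 2
                * ‖f z‖ ^ 2)
            ≤ C * R ^ (-ε) *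
              ((∫ z : E2 × E2, ∑ j : Fin 2,
                  ‖fderiv ℝ (fun y : E2 => f (y, z.2)) z.1 (EuclideanSpace.single j 1)‖ ^ 2)
                + ∫ z : E2 × E2, ‖f z‖ ^ 2) := by
  have hcs : HasCompactSupport χ := by
    refine HasCompactSupport.intro (isCompact_closedBall (0 : E2) 2) fun x hx => ?_
    refine hχ_outer x ?_
    simp only [Metric.mem_closedBall, dist_zero_right, not_le] at hx
    exact hx.le
  have hc := hχ_smooth.continuous
  obtain ⟨M, hM⟩ := hcs.exists_bound_of_continuous hc
  obtain ⟨K, hK0, hK⟩ := pot_unit χ hc (hc.integrable_of_hasCompactSupport hcs) hχ_nonneg hχ_mass M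
    (fun x => (le_abs_self _).trans (hM x)) hχ_outer
  set s : ℝ := min (ε / 2) (1 / 2) with hs_def
  have hs : 0 < s := lt_min (by positivity) (by norm_num)
  have hs2 : s ≤ 1 / 2 := min_le_right _ _
  have hsε : 2 * s ≤ ε := by
    have : s ≤ ε / 2 := min_le_left _ _
    linarith
  refine ⟨9 * K ^ 2 * (1 + 4 / s ^ 2), by positivity, ?_⟩
  intro R hR hR1 f hf hfs
  have hpot := pot_scaled χ K hK R hR
  have hgrad := grad_bound (fun y => R ^ (-2 : ℤ) * χ (R⁻¹ • y)) (by fun_prop)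
    ((hcs.comp_smul (inv_ne_zero hR.ne')).mul_left)
    (fun x => mul_nonneg (by positivity) (hχ_nonneg _)) K R hK0 hR hpot
  have hH := hardy R s hR hs hs2 f hf hfs
  have hqc : Continuous (fun z : E2 × E2 => (‖z.1 - z.2‖ ^ 2 + R ^ 2) ^ (s - 1)) := by
    refine Continuous.rpow_const (by fun_prop) ?_
    intro z; left; positivity
  have hφs : HasCompactSupport (fun z => ‖f z‖ ^ 2) := by
    refine hfs.mono ?_
    intro z hz; contrapose! hz; simp at hz; simp [hz]
  have hfc := hf.continuous
  have iI : Integrable (fun z : E2 × E2 => (‖z.1 - z.2‖ ^ 2 + R ^ 2) ^ (s - 1) * ‖f z‖ ^ 2) :=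
    (hqc.mul (hfc.norm.pow 2)).integrable_of_hasCompactSupport hφs.mul_left
  refine le_trans (integral_mono_of_nonneg (g := fun z : E2 × E2 => (9 * K ^ 2 * R ^ (-ε)) *
    ((‖z.1 - z.2‖ ^ 2 + R ^ 2) ^ (s - 1) * ‖f z‖ ^ 2)) (Filter.Eventually.of_forall fun z => ?_)
    (iI.const_mul _) (Filter.Eventually.of_forall fun z => ?_)) ?_
  · exact mul_nonneg (sq_nonneg _) (sq_nonneg _)
  · have hq : 0 < ‖z.1 - z.2‖ ^ 2 + R ^ 2 := by positivity
    have h1 : (‖z.1 - z.2‖ ^ 2 + R ^ 2)⁻¹ ≤ R ^ (-ε) * (‖z.1 - z.2‖ ^ 2 + R ^ 2) ^ (s - 1) := by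
      have e : (‖z.1 - z.2‖ ^ 2 + R ^ 2)⁻¹ =
          (‖z.1 - z.2‖ ^ 2 + R ^ 2) ^ (-s) * (‖z.1 - z.2‖ ^ 2 + R ^ 2) ^ (s - 1) := by
        rw [← Real.rpow_add hq, ← Real.rpow_neg_one]
        congr 1; ring
      rw [e]
      refine mul_le_mul_of_nonneg_right ?_ (Real.rpow_nonneg hq.le _)
      calc (‖z.1 - z.2‖ ^ 2 + R ^ 2) ^ (-s) ≤ (R ^ 2) ^ (-s) :=
            Real.rpow_le_rpow_of_nonpos (by positivity)
              (by nlinarith [sq_nonneg ‖z.1 - z.2‖]) (by linarith)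
        _ = R ^ (-(2 * s)) := by
            rw [← Real.rpow_natCast, ← Real.rpow_mul hR.le]
            congr 1; push_cast; ring
        _ ≤ R ^ (-ε) := Real.rpow_le_rpow_of_exponent_ge hR hR1 (by linarith)
    have h2 := (hgrad (z.1 - z.2)).trans
      (mul_le_mul_of_nonneg_left h1 (show 0 ≤ 9 * K ^ 2 by positivity))
    have h3 := mul_le_mul_of_nonneg_right h2 (sq_nonneg ‖f z‖)
    refine h3.trans (le_of_eq ?_)
    ring
  · rw [integral_const_mul]
    have := mul_le_mul_of_nonneg_left hH (show 0 ≤ 9 * K ^ 2 * R ^ (-ε) by positivity)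
    refine this.trans (le_of_eq ?_)
    ring
end
end

section
/- In the case where all three edge lengths are at least 2R, the cyclic sum Σ_cyc ∇w_R(x-y)·∇w_R(x-z) equals Σ_cyc (x-y)·(x-z)/(|x-y|²|x-z|²) = (1/2)ℛ(x,y,z)^{-2} ≤ (9/2)ρ(x,y,z)^{-2}. -/
open MeasureTheory RealInnerProductSpace
noncomputable section

lemma newton_complex (k : ℂ → ℝ) (hk : Continuous k) (r : ℝ)
    (hrad : ∀ x y : ℂ, ‖x‖ = ‖y‖ → k x = k y) (hout : ∀ x, r ≤ ‖x‖ → k x = 0)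
    (v : ℂ) (hv : r < ‖v‖) :
    ∫ w, Real.log ‖v - w‖ * k w = Real.log ‖v‖ * ∫ w, k w := by
  have hg : Continuous (fun w : ℂ => Real.log ‖v - w‖ * k w) := by
    rw [continuous_iff_continuousAt]
    intro w
    by_cases hw : w = v
    · have : (fun w : ℂ => Real.log ‖v - w‖ * k w) =ᶠ[nhds w] fun _ => 0 := by
        have : ∀ᶠ u : ℂ in nhds w, r < ‖u‖ :=
          (isOpen_lt continuous_const continuous_norm).mem_nhds (by simpa [hw] using hv)
        filter_upwards [this] with u hu
        rw [hout u hu.le, mul_zero]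
      exact (continuousAt_const).congr this.symm
    · refine ContinuousAt.mul (ContinuousAt.log (by fun_prop) ?_) hk.continuousAt
      rw [norm_ne_zero_iff, sub_ne_zero]; exact fun h => hw h.symm
  have hcm : Continuous (circleMap 0 1) := continuous_circleMap 0 1
  have hnorm : ∀ θ : ℝ, ‖circleMap 0 1 θ‖ = 1 := fun θ => by simp
  have hint : Integrable (Function.uncurry fun (θ : ℝ) (w : ℂ) =>
      Real.log ‖v - circleMap 0 1 θ * w‖ * k (circleMap 0 1 θ * w))
      ((volume.restrict (Set.Ioc 0 (2 * Real.pi))).prod volume) := by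
    have hc : Continuous (Function.uncurry fun (θ : ℝ) (w : ℂ) =>
      Real.log ‖v - circleMap 0 1 θ * w‖ * k (circleMap 0 1 θ * w)) :=
      hg.comp (f := fun p : ℝ × ℂ => circleMap 0 1 p.1 * p.2) (by fun_prop)
    have h1 : IntegrableOn (Function.uncurry fun (θ : ℝ) (w : ℂ) =>
      Real.log ‖v - circleMap 0 1 θ * w‖ * k (circleMap 0 1 θ * w))
      (Set.Icc 0 (2 * Real.pi) ×ˢ Metric.closedBall 0 r) (volume.prod volume) :=
      hc.continuousOn.integrableOn_compact (isCompact_Icc.prod (isCompact_closedBall 0 r))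
    have h2 : IntegrableOn (Function.uncurry fun (θ : ℝ) (w : ℂ) =>
      Real.log ‖v - circleMap 0 1 θ * w‖ * k (circleMap 0 1 θ * w))
      (Set.Icc 0 (2 * Real.pi) ×ˢ Set.univ) (volume.prod volume) := by
      refine h1.of_forall_sdiff_eq_zero (measurableSet_Icc.prod MeasurableSet.univ) ?_
      rintro ⟨θ, w⟩ ⟨hp, hq⟩
      have : r ≤ ‖w‖ := by
        by_contra hlt
        exact hq ⟨hp.1, by simpa using (not_le.1 hlt).le⟩
      simp only [Function.uncurry]
      rw [hout _ (by rw [norm_mul, hnorm]; simpa using this), mul_zero]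
    have h3 := h2.mono_set (Set.prod_mono_left (t := Set.univ)
      (Set.Ioc_subset_Icc_self (a := (0:ℝ)) (b := 2 * Real.pi)))
    rw [IntegrableOn, ← Measure.prod_restrict, Measure.restrict_univ] at h3
    exact h3
  have hswap := integral_integral_swap hint
  have hL : ∀ θ : ℝ, ∫ w, Real.log ‖v - circleMap 0 1 θ * w‖ * k (circleMap 0 1 θ * w)
      = ∫ w, Real.log ‖v - w‖ * k w := by
    intro θ
    have hc : circleMap 0 1 θ ∈ Submonoid.unitSphere ℂ := by
      simp [Submonoid.unitSphere]
    let c : Circle := ⟨circleMap 0 1 θ, hc⟩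
    exact (rotation c).measurePreserving.integral_comp
      (rotation c).toHomeomorph.measurableEmbedding (fun w => Real.log ‖v - w‖ * k w)
  have hRt : ∀ w : ℂ, ∫ θ in Set.Ioc 0 (2 * Real.pi),
      Real.log ‖v - circleMap 0 1 θ * w‖ * k (circleMap 0 1 θ * w)
      = 2 * Real.pi * (Real.log ‖v‖ * k w) := by
    intro w
    have hkk : ∀ θ : ℝ, k (circleMap 0 1 θ * w) = k w := fun θ => 
      hrad _ _ (by rw [norm_mul, hnorm, one_mul])
    simp only [hkk]
    rw [integral_mul_const]
    by_cases hw : r ≤ ‖w‖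
    · rw [hout w hw]; simp
    have hav := AnalyticOnNhd.circleAverage_log_norm_of_ne_zero (R := 1) (c := 0)
      (g := fun u : ℂ => v - u * w) (fun u _ => by fun_prop) (by
        intro u hu h0
        have hu1 : ‖u‖ ≤ 1 := by simpa using hu
        have : ‖v‖ = ‖u‖ * ‖w‖ := by rw [← norm_mul, sub_eq_zero.1 h0]
        have := mul_le_of_le_one_left (norm_nonneg w) hu1
        linarith)
    rw [Real.circleAverage_def, intervalIntegral.integral_of_le (by positivity)] at hav
    simp only [smul_eq_mul, zero_mul, sub_zero] at hav
    rw [← mul_assoc, ← hav, mul_inv_cancel_left₀ (by positivity)]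
  simp only [hL, hRt] at hswap
  rw [integral_const, integral_const_mul, integral_const_mul] at hswap
  simp only [smul_eq_mul] at hswap
  have hp : (volume.restrict (Set.Ioc 0 (2 * Real.pi))).real Set.univ = 2 * Real.pi := by
    simp [Measure.real, Real.pi_pos.le]
  rw [hp] at hswap
  exact mul_left_cancel₀ (by positivity) hswap

lemma newton_E2 (k : E2 → ℝ) (hk : Continuous k) (r : ℝ)
    (hrad : ∀ x y : E2, ‖x‖ = ‖y‖ → k x = k y) (hout : ∀ x, r ≤ ‖x‖ → k x = 0)
    (v : E2) (hv : r < ‖v‖) :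
    ∫ w, Real.log ‖v - w‖ * k w = Real.log ‖v‖ * ∫ w, k w := by
  let e : ℂ ≃ₗᵢ[ℝ] E2 := Complex.orthonormalBasisOneI.repr
  have key := newton_complex (k ∘ e) (hk.comp e.continuous) r
    (fun x y h => hrad _ _ (by simpa using h)) (fun x h => hout _ (by simpa using h))
    (e.symm v) (by simpa using hv)
  have h1 := e.measurePreserving.integral_comp e.toHomeomorph.measurableEmbedding k
  have h2 := e.measurePreserving.integral_comp e.toHomeomorph.measurableEmbedding
    (fun w => Real.log ‖v - w‖ * k w)
  have h3 : ∀ w : ℂ, ‖v - e w‖ = ‖e.symm v - w‖ := by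
    intro w
    rw [← e.norm_map (e.symm v - w)]; simp
  simp only [h3] at h2
  simp only [Function.comp_def, h1, h2, LinearIsometryEquiv.norm_map] at key
  exact key

lemma locInt_log : LocallyIntegrable (fun x : E2 => Real.log ‖x‖) volume := by
  have hb : ∀ r : ℝ, IntegrableOn (fun x : E2 => Real.log ‖x‖) (Metric.ball 0 r) volume := by
    intro r
    rw [integrableOn_fun_norm_addHaar volume (f := Real.log)]
    have hc : Continuous (fun y : ℝ => y ^ (Module.finrank ℝ E2 - 1) • Real.log y) := by
      simpa using Real.continuous_mul_log
    exact (hc.continuousOn.integrableOn_compact isCompact_Icc).mono_set Set.Ioo_subset_Icc_self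
  intro x
  exact ⟨_, Metric.isOpen_ball.mem_nhds (by simp : x ∈ Metric.ball (0:E2) (‖x‖ + 1)), hb _⟩

lemma hasGrad_log (v : E2) (hv : v ≠ 0) :
    HasGradientAt (fun x : E2 => Real.log ‖x‖) ((‖v‖ ^ 2)⁻¹ • v) v := by
  have h1 : HasFDerivAt (fun x : E2 => ‖x‖ ^ 2) _ v := (hasStrictFDerivAt_norm_sq v).hasFDerivAt
  have h2 := (h1.log (by positivity)).const_mul (1 / 2 : ℝ)
  have h3 : (fun x : E2 => Real.log ‖x‖) = fun x => (1 / 2 : ℝ) * Real.log (‖x‖ ^ 2) := by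
    ext x; rw [Real.log_pow]; push_cast; ring
  rw [hasGradientAt_iff_hasFDerivAt, h3]
  refine h2.congr_fderiv ?_
  ext1 u
  simp
  ring

lemma grad_conv (k : E2 → ℝ) (hk : ContDiff ℝ (⊤ : ℕ∞) k) (r : ℝ) (hr : 0 < r)
    (hrad : ∀ x y : E2, ‖x‖ = ‖y‖ → k x = k y) (hout : ∀ x, r ≤ ‖x‖ → k x = 0)
    (hm : ∫ w, k w = 1) (v : E2) (hv : r ≤ ‖v‖) :
    gradient (fun v : E2 => ∫ w, Real.log ‖v - w‖ * k w) v = (‖v‖ ^ 2)⁻¹ • v := by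
  set W := fun v : E2 => ∫ w, Real.log ‖v - w‖ * k w with hW
  have hcs : HasCompactSupport k :=
    HasCompactSupport.intro (isCompact_closedBall 0 r) (fun x hx => hout x (by
      simp at hx; exact hx.le))
  have hsm : ContDiff ℝ (⊤ : ℕ∞) W := by
    have := hcs.contDiff_convolution_left (ContinuousLinearMap.mul ℝ ℝ) hk locInt_log
    convert this using 1
    ext v
    simp [hW, convolution_def, mul_comm]
  have hcont : Continuous (gradient W) :=
    (InnerProductSpace.toDual ℝ E2).symm.continuous.comp (hsm.continuous_fderiv (by simp))
  have hopen : ∀ u : E2, r < ‖u‖ → gradient W u = (‖u‖ ^ 2)⁻¹ • u := by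
    intro u hu
    have hu0 : u ≠ 0 := by rw [← norm_pos_iff]; linarith
    refine HasGradientAt.gradient ((hasGrad_log u hu0).congr_of_eventuallyEq ?_)
    filter_upwards [(isOpen_lt continuous_const continuous_norm).mem_nhds hu] with a ha
    rw [hW]
    simp only
    rw [newton_E2 k hk.continuous r hrad hout a ha, hm, mul_one]
  have hv0 : v ≠ 0 := by rw [← norm_pos_iff]; linarith
  have ht : Filter.Tendsto (fun t : ℝ => t • v) (nhdsWithin 1 (Set.Ioi 1)) (nhds v) := by
    have : ContinuousAt (fun t : ℝ => t • v) 1 := by fun_prop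
    have h := this.tendsto
    rw [one_smul] at h
    exact h.mono_left nhdsWithin_le_nhds
  have hc2 : ContinuousAt (fun u : E2 => (‖u‖ ^ 2)⁻¹ • u) v := by
    have h0 : ContinuousAt (fun u : E2 => ‖u‖ ^ 2) v := by fun_prop
    exact (h0.inv₀ (by positivity)).smul continuousAt_id
  refine tendsto_nhds_unique (hcont.continuousAt.tendsto.comp ht)
    ((hc2.tendsto.comp ht).congr' ?_)
  filter_upwards [self_mem_nhdsWithin] with t ht
  refine (hopen _ ?_).symm
  have ht1 : (1:ℝ) < t := ht
  rw [norm_smul, Real.norm_of_nonneg (by linarith)]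
  nlinarith

lemma grad_R
    (χ : E2 → ℝ)
    (hχ_smooth : ContDiff ℝ (⊤ : ℕ∞) χ)
    (hχ_radial : ∀ x y : E2, ‖x‖ = ‖y‖ → χ x = χ y)
    (hχ_mass : ∫ x, χ x = 1)
    (hχ_outer : ∀ x : E2, 2 ≤ ‖x‖ → χ x = 0)
    (R : ℝ) (hR : 0 < R) (v : E2) (hv : 2 * R ≤ ‖v‖) :
    gradient (fun v : E2 => ∫ w : E2,
          Real.log ‖v - w‖ * (R ^ (-2 : ℤ) * χ (R⁻¹ • w))) v = (‖v‖ ^ 2)⁻¹ • v := by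
  have hRi : ‖R⁻¹‖ = R⁻¹ := Real.norm_of_nonneg (by positivity)
  refine grad_conv (fun w => R ^ (-2 : ℤ) * χ (R⁻¹ • w)) ?_ (2 * R) (by positivity) ?_ ?_ ?_ v hv
  · exact contDiff_const.mul (hχ_smooth.comp (contDiff_const_smul _))
  · intro x y h
    rw [hχ_radial (R⁻¹ • x) (R⁻¹ • y) (by rw [norm_smul, norm_smul, h])]
  · intro x h
    rw [hχ_outer, mul_zero]
    rw [norm_smul, hRi, inv_mul_eq_div, le_div_iff₀ hR]
    exact h
  · rw [integral_const_mul, Measure.integral_comp_smul, hχ_mass]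
    simp
    field_simp

lemma tri (a1 a2 b1 b2 c1 c2 s A B C : ℝ) (ha : a1^2+a2^2 = s) (hb : b1^2+b2^2 = s)
    (hc : c1^2+c2^2 = s) (hA : (a1-b1)^2+(a2-b2)^2 = A) (hB : (b1-c1)^2+(b2-c2)^2 = B)
    (hC : (c1-a1)^2+(c2-a2)^2 = C) (hA0 : 0 < A) (hB0 : 0 < B) (hC0 : 0 < C) (hs : 0 < s) :
    ((a1-b1)*(a1-c1)+(a2-b2)*(a2-c2))/(A*C) + ((b1-c1)*(b1-a1)+(b2-c2)*(b2-a2))/(B*A)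
     + ((c1-a1)*(c1-b1)+(c2-a2)*(c2-b2))/(C*B) = 1/2 * s⁻¹ ∧ 1/2 * s⁻¹ ≤ 9/2/(A+B+C) := by
  constructor
  · have key : 4 * ((b1-a1)*(c2-a2)-(b2-a2)*(c1-a1))^2 * s = A*B*C := by
      set D := (b1-a1)*(c2-a2)-(b2-a2)*(c1-a1) with hD
      have e1 : 2 * D * (-a1) = A * (c2-a2) - C * (b2-a2) := by
        rw [← hA, ← hC]
        linear_combination (c2-a2)*(ha-hb) - (b2-a2)*(ha-hc) + 0*hD
      have e2 : 2 * D * (-a2) = -(A * (c1-a1) - C * (b1-a1)) := by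
        rw [← hA, ← hC]
        linear_combination -((c1-a1)*(ha-hb) - (b1-a1)*(ha-hc))
      have : 4 * D^2 * s = (A * (c2-a2) - C * (b2-a2))^2 + (A * (c1-a1) - C * (b1-a1))^2 := by
        rw [← ha]
        linear_combination (2 * D * (-a1) + (A * (c2-a2) - C * (b2-a2))) * e1 +
          (2 * D * (-a2) - (A * (c1-a1) - C * (b1-a1))) * e2
      rw [this, ← hA, ← hB, ← hC]; ring
    have num : ((a1-b1)*(a1-c1)+(a2-b2)*(a2-c2))*B + ((b1-c1)*(b1-a1)+(b2-c2)*(b2-a2))*C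
     + ((c1-a1)*(c1-b1)+(c2-a2)*(c2-b2))*A = 2 * ((b1-a1)*(c2-a2)-(b2-a2)*(c1-a1))^2 := by
      rw [← hA, ← hB, ← hC]; ring
    field_simp
    linear_combination 2 * s * num + key
  · have : A + B + C ≤ 9 * s := by
      nlinarith [sq_nonneg (a1+b1+c1), sq_nonneg (a2+b2+c2)]
    rw [← div_eq_mul_inv, div_le_div_iff₀ hs (by positivity)]
    linarith

/-- When all three edges of the triangle `(x,y,z)` have length at least `2R`, the cyclic
sum `Σ_cyc ∇w_R(x-y)·∇w_R(x-z)` equals `Σ_cyc (x-y)·(x-z)/(|x-y|²|x-z|²) = (1/2)ℛ⁻²`,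
and is bounded by `(9/2)ρ⁻²`. -/
theorem three_body_long_edges
    (χ : E2 → ℝ)
    (hχ_smooth : ContDiff ℝ (⊤ : ℕ∞) χ)
    (hχ_radial : ∀ x y : E2, ‖x‖ = ‖y‖ → χ x = χ y)
    (hχ_nonneg : ∀ x, 0 ≤ χ x)
    (hχ_mass : ∫ x, χ x = 1)
    (hχ_inner : ∀ x : E2, ‖x‖ ≤ 1 → χ x = 1 / Real.pi ^ 2)
    (hχ_outer : ∀ x : E2, 2 ≤ ‖x‖ → χ x = 0)
    (R : ℝ) (hR : 0 < R)
    (x y z : E2) (h : AffineIndependent ℝ ![x, y, z])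
    (hxy : 2 * R ≤ ‖x - y‖) (hyz : 2 * R ≤ ‖y - z‖) (hzx : 2 * R ≤ ‖z - x‖) :
    (⟪gradient (fun v : E2 => ∫ w : E2,
          Real.log ‖v - w‖ * (R ^ (-2 : ℤ) * χ (R⁻¹ • w))) (x - y),
        gradient (fun v : E2 => ∫ w : E2,
          Real.log ‖v - w‖ * (R ^ (-2 : ℤ) * χ (R⁻¹ • w))) (x - z)⟫
      + ⟪gradient (fun v : E2 => ∫ w : E2,
          Real.log ‖v - w‖ * (R ^ (-2 : ℤ) * χ (R⁻¹ • w))) (y - z),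
        gradient (fun v : E2 => ∫ w : E2,
          Real.log ‖v - w‖ * (R ^ (-2 : ℤ) * χ (R⁻¹ • w))) (y - x)⟫
      + ⟪gradient (fun v : E2 => ∫ w : E2,
          Real.log ‖v - w‖ * (R ^ (-2 : ℤ) * χ (R⁻¹ • w))) (z - x),
        gradient (fun v : E2 => ∫ w : E2,
          Real.log ‖v - w‖ * (R ^ (-2 : ℤ) * χ (R⁻¹ • w))) (z - y)⟫
      = ⟪x - y, x - z⟫ / (‖x - y‖ ^ 2 * ‖x - z‖ ^ 2)
        + ⟪y - z, y - x⟫ / (‖y - z‖ ^ 2 * ‖y - x‖ ^ 2)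
        + ⟪z - x, z - y⟫ / (‖z - x‖ ^ 2 * ‖z - y‖ ^ 2))
    ∧ (⟪x - y, x - z⟫ / (‖x - y‖ ^ 2 * ‖x - z‖ ^ 2)
        + ⟪y - z, y - x⟫ / (‖y - z‖ ^ 2 * ‖y - x‖ ^ 2)
        + ⟪z - x, z - y⟫ / (‖z - x‖ ^ 2 * ‖z - y‖ ^ 2)
      = (1 / 2) * ((Affine.Simplex.circumradius ⟨![x, y, z], h⟩)⁻¹) ^ 2)
    ∧ (⟪x - y, x - z⟫ / (‖x - y‖ ^ 2 * ‖x - z‖ ^ 2)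
        + ⟪y - z, y - x⟫ / (‖y - z‖ ^ 2 * ‖y - x‖ ^ 2)
        + ⟪z - x, z - y⟫ / (‖z - x‖ ^ 2 * ‖z - y‖ ^ 2)
      ≤ (9 / 2) / (‖x - y‖ ^ 2 + ‖y - z‖ ^ 2 + ‖z - x‖ ^ 2)) := by
  have gr := grad_R χ hχ_smooth hχ_radial hχ_mass hχ_outer R hR
  have hyx : 2 * R ≤ ‖y - x‖ := by rwa [norm_sub_rev]
  have hzy : 2 * R ≤ ‖z - y‖ := by rwa [norm_sub_rev]
  have hxz : 2 * R ≤ ‖x - z‖ := by rwa [norm_sub_rev]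
  constructor
  · rw [gr _ hxy, gr _ hyx, gr _ hyz, gr _ hzy, gr _ hzx, gr _ hxz]
    simp only [real_inner_smul_left, real_inner_smul_right, div_eq_mul_inv, mul_inv]
    ring
  · set T : Affine.Simplex ℝ E2 2 := ⟨![x, y, z], h⟩ with hT
    have d0 : dist x T.circumcenter = T.circumradius := T.dist_circumcenter_eq_circumradius 0
    have d1 : dist y T.circumcenter = T.circumradius := T.dist_circumcenter_eq_circumradius 1
    have d2 : dist z T.circumcenter = T.circumradius := T.dist_circumcenter_eq_circumradius 2
    have hpos : 0 < T.circumradius := T.circumradius_pos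
    set p := T.circumcenter
    set s := T.circumradius
    have nsq : ∀ u : E2, ‖u‖ ^ 2 = u 0 ^ 2 + u 1 ^ 2 := fun u => by
      simp [EuclideanSpace.norm_sq_eq, Fin.sum_univ_two]
    have inn : ∀ u w : E2, ⟪u, w⟫ = u 0 * w 0 + u 1 * w 1 := fun u w => by
      simp [PiLp.inner_apply, Fin.sum_univ_two, mul_comm]
    have dd : ∀ u : E2, dist u p = s → (u 0 - p 0) ^ 2 + (u 1 - p 1) ^ 2 = s ^ 2 := by
      intro u hu
      rw [← hu, dist_eq_norm, nsq]; simp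
    have hA0 : 0 < ‖x - y‖ ^ 2 := pow_pos (by linarith) 2
    have hB0 : 0 < ‖y - z‖ ^ 2 := pow_pos (by linarith) 2
    have hC0 : 0 < ‖z - x‖ ^ 2 := pow_pos (by linarith) 2
    have key := tri (x 0 - p 0) (x 1 - p 1) (y 0 - p 0) (y 1 - p 1) (z 0 - p 0) (z 1 - p 1)
      (s ^ 2) (‖x - y‖ ^ 2) (‖y - z‖ ^ 2) (‖z - x‖ ^ 2) (dd x d0) (dd y d1) (dd z d2)
      (by rw [nsq]; simp) (by rw [nsq]; simp) (by rw [nsq]; simp) hA0 hB0 hC0 (by positivity)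
    simp only [sub_sub_sub_cancel_right] at key
    have hE : ⟪x - y, x - z⟫ / (‖x - y‖ ^ 2 * ‖x - z‖ ^ 2)
        + ⟪y - z, y - x⟫ / (‖y - z‖ ^ 2 * ‖y - x‖ ^ 2)
        + ⟪z - x, z - y⟫ / (‖z - x‖ ^ 2 * ‖z - y‖ ^ 2) = 1 / 2 * (s ^ 2)⁻¹ := by
      rw [← key.1, norm_sub_rev x z, norm_sub_rev y x, norm_sub_rev z y]
      simp only [inn, PiLp.sub_apply]
    rw [hE]
    exact ⟨by rw [inv_pow], key.2⟩
end
end
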